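/- arXiv:2505.12633 — 3 statements merged into one kernel-verified Lean document; each statement's English description precedes it below -/
import Mathlib

section
/- Let k > 0, w < 0 and ν > 0 be real numbers. Then ∫₀^∞ s^{ν−1} e^{−ks} (s − w)^{−1} ds = (−w)^{ν−1} · e^{−kw} · Γ(ν) · ∫_{−kw}^∞ t^{−ν} e^{−t} dt, where the last integral is the upper incomplete Gamma function Γ(1−ν, −kw) (note −kw > 0, so both integrals converge). -/
open MeasureTheory

/-- The Laplace-type kernel behind the incomplete Gamma function is integrable on
`(0, ∞) × (k, ∞)`. -/
theorem integrable_rpow_mul_exp_neg_mul_add {k a ν : ℝ} (hk : 0 < k) (ha : 0 < a) (hν : 0 < ν) :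
    Integrable (Function.uncurry fun s x : ℝ => s ^ (ν - 1) * Real.exp (-(s + a) * x))
      ((volume.restrict (Set.Ioi 0)).prod (volume.restrict (Set.Ioi k))) := by
  have hmeas : Measurable
      (Function.uncurry fun s x : ℝ => s ^ (ν - 1) * Real.exp (-(s + a) * x)) := by
    unfold Function.uncurry
    fun_prop
  rw [integrable_prod_iff hmeas.aestronglyMeasurable]
  constructor
  · filter_upwards [ae_restrict_mem measurableSet_Ioi] with s hs
    have hs : 0 < s := hs
    exact (integrableOn_exp_mul_Ioi (a := -(s + a)) (by linarith) k).const_mul (s ^ (ν - 1))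
  · have hdom : IntegrableOn (fun s : ℝ => s ^ (ν - 1) * Real.exp (-k * s) * a⁻¹) (Set.Ioi 0) := by
      have h := integrableOn_rpow_mul_exp_neg_mul_rpow (s := ν - 1) (by linarith) one_pos hk
      simp only [Real.rpow_one] at h
      exact h.mul_const _
    refine Integrable.mono' hdom
      hmeas.norm.stronglyMeasurable.integral_prod_right.aestronglyMeasurable ?_
    filter_upwards [ae_restrict_mem measurableSet_Ioi] with s hs
    have hs : 0 < s := hs
    have hpow : 0 ≤ s ^ (ν - 1) := Real.rpow_nonneg hs.le _
    simp only [Function.uncurry, norm_mul, Real.norm_of_nonneg hpow,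
      Real.norm_of_nonneg (Real.exp_nonneg _)]
    rw [integral_const_mul, integral_exp_mul_Ioi (by linarith), neg_div_neg_eq, norm_mul,
      norm_div, Real.norm_of_nonneg hpow, Real.norm_of_nonneg (Real.exp_nonneg _),
      Real.norm_of_nonneg (by positivity), mul_assoc, div_eq_mul_inv]
    have hexp : -(s + a) * k ≤ -k * s := by linarith [mul_pos ha hk]
    have hle : a ≤ s + a := by linarith
    gcongr s ^ (ν - 1) * (Real.exp ?_ * ?_⁻¹)

/-- Incomplete-Gamma evaluation (real-parameter form):
`∫₀^∞ s^{ν-1} e^{-ks} (s-w)⁻¹ ds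
  = (-w)^{ν-1} e^{-kw} Γ(ν) ∫_{-kw}^∞ t^{-ν} e^{-t} dt` for `k > 0`, `w < 0`,
`ν > 0`. -/
theorem incomplete_gamma_eval
    (k w ν : ℝ) (hk : 0 < k) (hw : w < 0) (hν : 0 < ν) :
    (∫ s in Set.Ioi (0:ℝ), s ^ (ν - 1) * Real.exp (-k * s) / (s - w)) =
      (-w) ^ (ν - 1) * Real.exp (-k * w) * Real.Gamma ν *
        ∫ t in Set.Ioi (-k * w), t ^ (-ν) * Real.exp (-t) := by
  obtain ⟨a, rfl⟩ : ∃ a, w = -a := ⟨-w, (neg_neg w).symm⟩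
  have ha : 0 < a := by linarith
  calc
    _ = ∫ s in Set.Ioi (0:ℝ), Real.exp (k * a) *
          ∫ x in Set.Ioi k, s ^ (ν - 1) * Real.exp (-(s + a) * x) := by
      refine setIntegral_congr_fun measurableSet_Ioi fun s hs => ?_
      have hs : 0 < s := hs
      have hexp : Real.exp (-k * s) = Real.exp (k * a) * Real.exp (-(s + a) * k) := by
        rw [← Real.exp_add]
        ring_nf
      rw [integral_const_mul, integral_exp_mul_Ioi (by linarith), neg_div_neg_eq, hexp,
        sub_neg_eq_add]
      ring
    _ = Real.exp (k * a) * ∫ x in Set.Ioi k,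
          ∫ s in Set.Ioi (0:ℝ), s ^ (ν - 1) * Real.exp (-(s + a) * x) := by
      rw [integral_const_mul,
        integral_integral_swap (integrable_rpow_mul_exp_neg_mul_add hk ha hν)]
    _ = Real.exp (k * a) * ∫ x in Set.Ioi k,
          (Real.Gamma ν * a ^ ν) * ((a * x) ^ (-ν) * Real.exp (-(a * x))) := by
      congr 1
      refine setIntegral_congr_fun measurableSet_Ioi fun x hx => ?_
      have hx : 0 < x := hk.trans hx
      have hexp (s : ℝ) : s ^ (ν - 1) * Real.exp (-(s + a) * x) =
          s ^ (ν - 1) * Real.exp (-(x * s)) * Real.exp (-(a * x)) := by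
        rw [mul_assoc, ← Real.exp_add]
        ring_nf
      simp only [hexp]
      rw [integral_mul_const, Real.integral_rpow_mul_exp_neg_mul_Ioi hν hx, one_div,
        Real.inv_rpow hx.le, Real.mul_rpow ha.le hx.le, Real.rpow_neg ha.le, Real.rpow_neg hx.le]
      have := (Real.rpow_pos_of_pos ha ν).ne'
      field_simp
    _ = _ := by
      rw [integral_const_mul,
        integral_comp_mul_left_Ioi (fun t => t ^ (-ν) * Real.exp (-t)) k ha, neg_neg,
        Real.rpow_sub_one ha.ne', smul_eq_mul, neg_mul_neg, mul_comm a k]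
      ring
end

section
/- Let c ∈ (0,1) and x > 0, and define E(z) = z·(1 − x²z)^c for z ∈ ℂ ∖ [x^{-2}, ∞), where (1 − x²z)^c is the principal complex power (note 1 − x²z ∉ (−∞,0] on this domain). If ζ ∈ ℂ ∖ {0} satisfies πc < |arg ζ| ≤ π (with arg taking values in (−π, π]), then there exists exactly one z ∈ ℂ ∖ [x^{-2}, ∞) with E(z) = ζ. -/
open Complex
open Filter Topology

/-- Positive definiteness of the cotangent form `a² cot A + b² cot B + (a + b)² cot C` of a triangle
with angles `A`, `B`, `C = π - (A + B)`, at `a = 1`, `b = c`. -/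
lemma cot_quadratic_form_pos {A B c : ℝ} (hc : 0 < c) (hA : 0 < Real.sin A) (hB : 0 < Real.sin B)
    (hAB : 0 < Real.sin (A + B)) :
    0 < Real.cos A / Real.sin A + c ^ 2 * (Real.cos B / Real.sin B)
      - (1 + c) ^ 2 * (Real.cos (A + B) / Real.sin (A + B)) := by
  have hdiffA : Real.cos A / Real.sin A - Real.cos (A + B) / Real.sin (A + B)
      = Real.sin B / (Real.sin A * Real.sin (A + B)) := by
    have h := Real.sin_sub (A + B) A
    rw [add_sub_cancel_left] at h
    rw [div_sub_div _ _ hA.ne' hAB.ne', h]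
    ring
  have hdiffB : Real.cos B / Real.sin B - Real.cos (A + B) / Real.sin (A + B)
      = Real.sin A / (Real.sin B * Real.sin (A + B)) := by
    have h := Real.sin_sub (A + B) B
    rw [add_sub_cancel_right] at h
    rw [div_sub_div _ _ hB.ne' hAB.ne', h]
    ring
  have key : Real.cos A / Real.sin A + c ^ 2 * (Real.cos B / Real.sin B)
      - (1 + c) ^ 2 * (Real.cos (A + B) / Real.sin (A + B))
      = ((Real.sin B - c * Real.sin A * Real.cos (A + B)) ^ 2
        + (c * Real.sin A * Real.sin (A + B)) ^ 2)
          / (Real.sin A * Real.sin B * Real.sin (A + B)) := by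
    have hnum : (Real.sin B - c * Real.sin A * Real.cos (A + B)) ^ 2
        + (c * Real.sin A * Real.sin (A + B)) ^ 2
        = Real.sin B ^ 2 + c ^ 2 * Real.sin A ^ 2
          - 2 * c * Real.cos (A + B) * Real.sin A * Real.sin B := by
      linear_combination (c * Real.sin A) ^ 2 * Real.sin_sq_add_cos_sq (A + B)
    have hsum : Real.cos A / Real.sin A + c ^ 2 * (Real.cos B / Real.sin B)
        - (1 + c) ^ 2 * (Real.cos (A + B) / Real.sin (A + B))
        = Real.sin B / (Real.sin A * Real.sin (A + B))
          + c ^ 2 * (Real.sin A / (Real.sin B * Real.sin (A + B)))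
          - 2 * c * (Real.cos (A + B) / Real.sin (A + B)) := by
      rw [← hdiffA, ← hdiffB]; ring
    rw [hnum, hsum]
    field_simp
  rw [key]
  positivity

/-- The logarithm of `‖w‖ * ‖1 - w‖ ^ c` along the level curve `arg w + c * arg (1 - w) = α` in the
upper half-plane, as a function of the angle `β` of the triangle `0, 1, w` at the vertex `1`. -/
noncomputable def logModulus (c α β : ℝ) : ℝ :=
  Real.log (Real.sin β) + c * Real.log (Real.sin (α + c * β))
    - (1 + c) * Real.log (Real.sin (α + (1 + c) * β))

section logModulus

variable {c α β : ℝ}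

lemma triangle_angles_mem_Ioo (hc : 0 < c) (hα : α ∈ Set.Ioo 0 Real.pi)
    (hβ : β ∈ Set.Ioo 0 ((Real.pi - α) / (1 + c))) :
    β ∈ Set.Ioo 0 Real.pi ∧ α + c * β ∈ Set.Ioo 0 Real.pi ∧
      α + (1 + c) * β ∈ Set.Ioo 0 Real.pi := by
  obtain ⟨hα0, hαπ⟩ := hα
  obtain ⟨hβ0, hβ1⟩ := hβ
  rw [lt_div_iff₀ (by linarith)] at hβ1
  have : 0 < c * β := mul_pos hc hβ0
  refine ⟨⟨hβ0, ?_⟩, ⟨?_, ?_⟩, ⟨?_, ?_⟩⟩ <;> nlinarith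

lemma hasDerivAt_logModulus (hc : 0 < c) (hα : α ∈ Set.Ioo 0 Real.pi)
    (hβ : β ∈ Set.Ioo 0 ((Real.pi - α) / (1 + c))) :
    HasDerivAt (logModulus c α)
      (Real.cos β / Real.sin β + c ^ 2 * (Real.cos (α + c * β) / Real.sin (α + c * β))
        - (1 + c) ^ 2 *
          (Real.cos (α + (1 + c) * β) / Real.sin (α + (1 + c) * β))) β := by
  obtain ⟨h1, h2, h3⟩ := triangle_angles_mem_Ioo hc hα hβ
  have hlin (k : ℝ) : HasDerivAt (fun t : ℝ => α + k * t) k β := by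
    simpa using ((hasDerivAt_id β).const_mul k).const_add α
  have d1 := (Real.hasDerivAt_sin β).log (Real.sin_pos_of_mem_Ioo h1).ne'
  have d2 := ((hlin c).sin.log (Real.sin_pos_of_mem_Ioo h2).ne').const_mul c
  have d3 := ((hlin (1 + c)).sin.log (Real.sin_pos_of_mem_Ioo h3).ne').const_mul (1 + c)
  refine ((d1.add d2).sub d3).congr_deriv ?_
  ring

lemma continuousOn_logModulus (hc : 0 < c) (hα : α ∈ Set.Ioo 0 Real.pi) :
    ContinuousOn (logModulus c α) (Set.Ioo 0 ((Real.pi - α) / (1 + c))) :=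
  fun _ hβ => (hasDerivAt_logModulus hc hα hβ).continuousAt.continuousWithinAt

lemma strictMonoOn_logModulus (hc : 0 < c) (hα : α ∈ Set.Ioo 0 Real.pi) :
    StrictMonoOn (logModulus c α) (Set.Ioo 0 ((Real.pi - α) / (1 + c))) := by
  refine strictMonoOn_of_deriv_pos (convex_Ioo _ _) (continuousOn_logModulus hc hα) fun β hβ => ?_
  rw [interior_Ioo] at hβ
  obtain ⟨h1, h2, h3⟩ := triangle_angles_mem_Ioo hc hα hβ
  rw [(hasDerivAt_logModulus hc hα hβ).deriv]
  have hsum : α + (1 + c) * β = β + (α + c * β) := by ring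
  rw [hsum] at h3 ⊢
  exact cot_quadratic_form_pos hc (Real.sin_pos_of_mem_Ioo h1) (Real.sin_pos_of_mem_Ioo h2)
    (Real.sin_pos_of_mem_Ioo h3)

lemma exists_logModulus_eq (hc : 0 < c) (hα : α ∈ Set.Ioo 0 Real.pi) (y : ℝ) :
    ∃ β ∈ Set.Ioo 0 ((Real.pi - α) / (1 + c)), logModulus c α β = y := by
  set b := (Real.pi - α) / (1 + c) with hb
  have hc1 : 0 < 1 + c := by linarith
  have hb0 : 0 < b := div_pos (sub_pos.2 hα.2) hc1
  have hbα : α + (1 + c) * b = Real.pi := by rw [hb]; field_simp; ring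
  have hbπ : b < Real.pi := by nlinarith [hα.1, mul_pos hc hb0]
  have hsinb : 0 < Real.sin b := Real.sin_pos_of_pos_of_lt_pi hb0 hbπ
  have hsinb' : Real.sin (α + c * b) = Real.sin b := by
    rw [← Real.sin_pi_sub]; congr 1; linarith
  have hsinα : 0 < Real.sin α := Real.sin_pos_of_mem_Ioo hα
  have hlog (k t : ℝ) (h : Real.sin (α + k * t) ≠ 0) :
      ContinuousAt (fun s : ℝ => Real.log (Real.sin (α + k * s))) t :=
    ContinuousAt.log (by fun_prop) h
  have hbot : Tendsto (logModulus c α) (𝓝[Set.Ioo 0 b] 0) atBot := by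
    have t1 : Tendsto (fun s : ℝ => Real.log (Real.sin s)) (𝓝[Set.Ioo 0 b] 0) atBot := by
      refine Real.tendsto_log_nhdsGT_zero.comp (tendsto_nhdsWithin_iff.2 ⟨?_, ?_⟩)
      · simpa using (Real.continuous_sin.tendsto 0).mono_left nhdsWithin_le_nhds
      · filter_upwards [self_mem_nhdsWithin] with s hs
        exact Real.sin_pos_of_pos_of_lt_pi hs.1 (hs.2.trans hbπ)
    have t2 : ContinuousAt (fun s : ℝ => c * Real.log (Real.sin (α + c * s))
        - (1 + c) * Real.log (Real.sin (α + (1 + c) * s))) 0 :=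
      (continuousAt_const.mul (hlog c 0 (by simpa using hsinα.ne'))).sub
        (continuousAt_const.mul (hlog (1 + c) 0 (by simpa using hsinα.ne')))
    refine (t1.atBot_add (t2.tendsto.mono_left nhdsWithin_le_nhds)).congr fun s => ?_
    simp only [logModulus]; ring
  have htop : Tendsto (logModulus c α) (𝓝[Set.Ioo 0 b] b) atTop := by
    have t1 : Tendsto (fun s : ℝ => Real.log (Real.sin (α + (1 + c) * s)))
        (𝓝[Set.Ioo 0 b] b) atBot := by
      refine Real.tendsto_log_nhdsGT_zero.comp (tendsto_nhdsWithin_iff.2 ⟨?_, ?_⟩)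
      · have : ContinuousAt (fun s : ℝ => Real.sin (α + (1 + c) * s)) b := by fun_prop
        simpa [ContinuousAt, hbα] using this.tendsto.mono_left nhdsWithin_le_nhds
      · filter_upwards [self_mem_nhdsWithin] with s hs
        exact Real.sin_pos_of_mem_Ioo (triangle_angles_mem_Ioo hc hα hs).2.2
    have t2 : ContinuousAt (fun s : ℝ => Real.log (Real.sin s)
        + c * Real.log (Real.sin (α + c * s))) b :=
      (Real.continuous_sin.continuousAt.log hsinb.ne').add
        (continuousAt_const.mul (hlog c b (by rw [hsinb']; exact hsinb.ne')))
    have t3 := t1.const_mul_atBot_of_neg (neg_lt_zero.2 hc1)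
    refine ((t2.tendsto.mono_left nhdsWithin_le_nhds).add_atTop t3).congr fun s => ?_
    simp only [logModulus]; ring
  have : (𝓝[Set.Ioo 0 b] (0 : ℝ)).NeBot := by rw [nhdsWithin_Ioo_eq_nhdsGT hb0]; infer_instance
  have : (𝓝[Set.Ioo 0 b] b).NeBot := by rw [nhdsWithin_Ioo_eq_nhdsLT hb0]; infer_instance
  exact isPreconnected_Ioo.intermediate_value_Iii (l₁ := 𝓝[Set.Ioo 0 b] 0)
    (l₂ := 𝓝[Set.Ioo 0 b] b) inf_le_right inf_le_right
    (continuousOn_logModulus hc hα) hbot htop (Set.mem_univ y)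

end logModulus

/-- Law of sines in the triangle `0, 1, w`. -/
lemma triangle_law_of_sines {w : ℂ} (hw : 0 < w.im) :
    0 < w.arg ∧ (1 - w).arg < 0 ∧ w.arg - (1 - w).arg < Real.pi ∧
      ‖w‖ * Real.sin (w.arg - (1 - w).arg) = Real.sin (-(1 - w).arg) ∧
      ‖1 - w‖ * Real.sin (w.arg - (1 - w).arg) = Real.sin w.arg := by
  have hβ : (1 - w).arg < 0 := by rw [arg_neg_iff]; simpa using hw
  have hθ : 0 < w.arg := by
    refine lt_of_le_of_ne (arg_nonneg_iff.2 hw.le) fun h => ?_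
    exact hw.ne' (arg_eq_zero_iff.1 h.symm).2
  have h1 := norm_mul_cos_arg w
  have h2 := norm_mul_sin_arg w
  have h3 := norm_mul_cos_arg (1 - w)
  have h4 := norm_mul_sin_arg (1 - w)
  simp only [sub_re, one_re, sub_im, one_im, zero_sub] at h3 h4
  have e1 : ‖w‖ * Real.sin (w.arg - (1 - w).arg) = Real.sin (-(1 - w).arg) := by
    rw [Real.sin_sub, Real.sin_neg]
    linear_combination (Real.cos (1 - w).arg) * (h2 + h4) - Real.sin (1 - w).arg * (h1 + h3)
  have e2 : ‖1 - w‖ * Real.sin (w.arg - (1 - w).arg) = Real.sin w.arg := by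
    rw [Real.sin_sub]
    linear_combination Real.sin w.arg * (h1 + h3) - Real.cos w.arg * (h2 + h4)
  have hπ : w.arg - (1 - w).arg < Real.pi := by
    by_contra! h
    have hs : Real.sin (w.arg - (1 - w).arg) ≤ 0 := by
      rw [← neg_nonneg, ← Real.sin_sub_pi]
      exact Real.sin_nonneg_of_nonneg_of_le_pi (by linarith)
        (by linarith [arg_le_pi w, neg_pi_lt_arg (1 - w)])
    have hs' : 0 < Real.sin (-(1 - w).arg) :=
      Real.sin_pos_of_pos_of_lt_pi (by linarith) (by linarith [neg_pi_lt_arg (1 - w)])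
    nlinarith [norm_nonneg w]
  exact ⟨hθ, hβ, hπ, e1, e2⟩

lemma arg_one_sub_of_im_eq_zero {w : ℂ} (hs : 1 - w ∈ slitPlane) (hw : w.im = 0) :
    (1 - w).arg = 0 := by
  have h := mem_slitPlane_iff.1 hs
  simp only [sub_im, one_im, hw, sub_zero, ne_eq, not_true_eq_false, or_false] at h
  exact arg_eq_zero_iff.2 ⟨h.le, by simp [hw]⟩

lemma arg_mul_one_sub_cpow {c : ℝ} (hc : c ∈ Set.Ioo (0 : ℝ) 1) {w : ℂ} (hw : w ≠ 0)
    (hs : 1 - w ∈ slitPlane) :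
    (w * (1 - w) ^ (c : ℂ)).arg = w.arg + c * (1 - w).arg := by
  have h1w : 1 - w ≠ 0 := slitPlane_ne_zero hs
  have hpow : ((1 - w) ^ (c : ℂ)).arg = c * (1 - w).arg := by
    have him : (log (1 - w) * (c : ℂ)).im = c * (1 - w).arg := by
      rw [im_mul_ofReal, log_im, mul_comm]
    rw [cpow_def_of_ne_zero h1w, arg_exp, him, toIocMod_eq_self]
    constructor <;> nlinarith [neg_pi_lt_arg (1 - w), arg_le_pi (1 - w), hc.1, hc.2, Real.pi_pos]
  rw [arg_mul hw (by simp [cpow_eq_zero_iff, h1w]), hpow]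
  rw [hpow]
  rcases lt_trichotomy w.im 0 with h | h | h
  · have h' : 0 < (starRingEnd ℂ w).im := by simpa using h
    obtain ⟨a1, a2, -⟩ := triangle_law_of_sines h'
    have ec : (1 - starRingEnd ℂ w) = starRingEnd ℂ (1 - w) := by simp
    have hwπ : w.arg ≠ Real.pi := fun e => h.ne (arg_eq_pi_iff.1 e).2
    rw [ec, arg_conj, if_neg (mem_slitPlane_iff_arg.1 hs).1] at a2
    rw [arg_conj, if_neg hwπ] at a1
    constructor <;> nlinarith [hc.1, hc.2, neg_pi_lt_arg w, arg_le_pi (1 - w)]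
  · rw [arg_one_sub_of_im_eq_zero hs h, mul_zero, add_zero]
    exact arg_mem_Ioc w
  · obtain ⟨a1, a2, -⟩ := triangle_law_of_sines h
    constructor <;> nlinarith [hc.1, hc.2, neg_pi_lt_arg (1 - w), arg_le_pi w]

lemma norm_mul_one_sub_cpow (c : ℝ) (w : ℂ) :
    ‖w * (1 - w) ^ (c : ℂ)‖ = ‖w‖ * ‖1 - w‖ ^ c := by
  rw [norm_mul, norm_cpow_real]

/-- The triangle `0, 1, w` parametrized by its angle at `1`: the angle is in the expected range and
determines the modulus of `w * (1 - w) ^ c`. -/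
lemma log_norm_mul_one_sub_cpow {c α : ℝ} (hc : 0 < c) {w : ℂ} (hw : 0 < w.im)
    (hα : w.arg + c * (1 - w).arg = α) :
    -(1 - w).arg ∈ Set.Ioo 0 ((Real.pi - α) / (1 + c)) ∧
      Real.log ‖w * (1 - w) ^ (c : ℂ)‖ = logModulus c α (-(1 - w).arg) := by
  obtain ⟨hθ, hβ, hπ, e1, e2⟩ := triangle_law_of_sines hw
  refine ⟨⟨by linarith, ?_⟩, ?_⟩
  · rw [lt_div_iff₀ (by linarith)]
    linarith
  have hw0 : 0 < ‖w‖ := norm_pos_iff.2 fun h => by simp [h] at hw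
  have hw1 : 0 < ‖1 - w‖ := norm_pos_iff.2 fun h => by simp [← sub_eq_zero.1 h] at hw
  have hs : 0 < Real.sin (w.arg - (1 - w).arg) :=
    Real.sin_pos_of_pos_of_lt_pi (by linarith) hπ
  have a1 : α + c * -(1 - w).arg = w.arg := by linarith
  have a2 : α + (1 + c) * -(1 - w).arg = w.arg - (1 - w).arg := by linarith
  rw [norm_mul_one_sub_cpow, Real.log_mul hw0.ne' (by positivity), Real.log_rpow hw1, logModulus,
    a1, a2, ← e1, ← e2, Real.log_mul hw0.ne' hs.ne', Real.log_mul hw1.ne' hs.ne']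
  ring

lemma one_sub_mem_slitPlane_of_im_ne_zero {w : ℂ} (hw : w.im ≠ 0) : 1 - w ∈ slitPlane := by
  rw [mem_slitPlane_iff]
  right
  simpa using hw

/-- A point of the upper half-plane with prescribed angles `θ` at `0` and `β` at `1`. -/
lemma exists_triangle {θ β : ℝ} (hθ : 0 < θ) (hβ : 0 < β) (hπ : θ + β < Real.pi) :
    ∃ w : ℂ, 0 < w.im ∧ w.arg = θ ∧ (1 - w).arg = -β := by
  have hsθ : 0 < Real.sin θ := Real.sin_pos_of_pos_of_lt_pi hθ (by linarith)
  have hsβ : 0 < Real.sin β := Real.sin_pos_of_pos_of_lt_pi hβ (by linarith)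
  have hs : 0 < Real.sin (θ + β) := Real.sin_pos_of_pos_of_lt_pi (by linarith) hπ
  have hone : 1 - ((Real.sin β / Real.sin (θ + β) : ℝ) : ℂ) * (cos θ + sin θ * I)
      = ((Real.sin θ / Real.sin (θ + β) : ℝ) : ℂ) *
        (cos ((-β : ℝ) : ℂ) + sin ((-β : ℝ) : ℂ) * I) := by
    rw [← ofReal_cos, ← ofReal_sin, ← ofReal_cos, ← ofReal_sin]
    apply Complex.ext
    · simp only [sub_re, one_re, add_re, ofReal_re, mul_re, I_re, mul_zero, ofReal_im,
        I_im, zero_mul, sub_zero, add_zero, Real.cos_neg]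
      field_simp
      rw [Real.sin_add]
      ring
    · simp only [sub_im, one_im, add_im, ofReal_re, mul_im, I_re, mul_zero, ofReal_im,
        I_im, Real.sin_neg]
      field_simp
      ring
  refine ⟨((Real.sin β / Real.sin (θ + β) : ℝ) : ℂ) * (cos θ + sin θ * I), ?_, ?_, ?_⟩
  · rw [← ofReal_cos, ← ofReal_sin, im_ofReal_mul]
    simp only [add_im, ofReal_re, mul_im, I_re, mul_zero, ofReal_im, I_im]
    simp only [mul_one, zero_add, add_zero]
    positivity
  · exact arg_mul_cos_add_sin_mul_I (by positivity) ⟨by linarith, by linarith⟩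
  · rw [hone]
    exact arg_mul_cos_add_sin_mul_I (by positivity) ⟨by linarith, by linarith⟩

lemma existsUnique_upper_half_plane {c : ℝ} (hc : c ∈ Set.Ioo (0 : ℝ) 1) {ζ : ℂ} (hζ : 0 < ζ.im) :
    ∃! w : ℂ, 0 < w.im ∧ w * (1 - w) ^ (c : ℂ) = ζ := by
  have hζ0 : ζ ≠ 0 := fun h => by simp [h] at hζ
  have hα : ζ.arg ∈ Set.Ioo 0 Real.pi := by
    refine ⟨(triangle_law_of_sines hζ).1, lt_of_le_of_ne (arg_le_pi ζ) fun h => ?_⟩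
    exact hζ.ne' (arg_eq_pi_iff.1 h).2
  have hne {w : ℂ} (hw : 0 < w.im) : w ≠ 0 := fun h => by simp [h] at hw
  have harg {w : ℂ} (hw : 0 < w.im) := arg_mul_one_sub_cpow hc (hne hw)
    (one_sub_mem_slitPlane_of_im_ne_zero hw.ne')
  obtain ⟨β, hβ, hβeq⟩ := exists_logModulus_eq hc.1 hα (Real.log ‖ζ‖)
  obtain ⟨h1, h2, h3⟩ := triangle_angles_mem_Ioo hc.1 hα hβ
  obtain ⟨w, hw, hwarg, hwarg'⟩ := exists_triangle h2.1 h1.1 (by linarith [h3.2])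
  have hsum : w.arg + c * (1 - w).arg = ζ.arg := by rw [hwarg, hwarg']; ring
  refine ⟨w, ⟨hw, Complex.ext_norm_arg ?_ ((harg hw).trans hsum)⟩, ?_⟩
  · have hlog := (log_norm_mul_one_sub_cpow hc.1 hw hsum).2
    rw [hwarg', neg_neg, hβeq] at hlog
    refine Real.log_injOn_pos (norm_pos_iff.2 ?_) (norm_pos_iff.2 hζ0) hlog
    have : 1 - w ≠ 0 := slitPlane_ne_zero (one_sub_mem_slitPlane_of_im_ne_zero hw.ne')
    simp [cpow_eq_zero_iff, hne hw, this]
  · rintro v ⟨hv, hvζ⟩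
    have hvsum : v.arg + c * (1 - v).arg = ζ.arg := by rw [← harg hv, hvζ]
    obtain ⟨hmem, hlog⟩ := log_norm_mul_one_sub_cpow hc.1 hv hvsum
    rw [hvζ, ← hβeq] at hlog
    have hang : (1 - v).arg = (1 - w).arg := by
      rw [hwarg', (strictMonoOn_logModulus hc.1 hα).injOn hβ hmem hlog, neg_neg]
    have hang' : v.arg = w.arg := by rw [hang] at hvsum; linarith
    obtain ⟨a, b, d, e, -⟩ := triangle_law_of_sines hv
    obtain ⟨-, -, -, e', -⟩ := triangle_law_of_sines hw
    rw [← hang, ← hang', ← e] at e'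
    have hs := Real.sin_pos_of_pos_of_lt_pi (by linarith : 0 < v.arg - (1 - v).arg) d
    exact Complex.ext_norm_arg (mul_right_cancel₀ hs.ne' e').symm hang'

lemma existsUnique_mul_one_add_rpow {c R : ℝ} (hc : 0 < c) (hR : 0 < R) :
    ∃! r : ℝ, 0 < r ∧ r * (1 + r) ^ c = R := by
  have hmono : StrictMonoOn (fun r : ℝ => r * (1 + r) ^ c) (Set.Ici 0) := by
    intro a ha b hb hab
    have ha : 0 ≤ a := ha
    have h : (1 + a) ^ c ≤ (1 + b) ^ c := by gcongr
    have h' : 0 < (1 + b) ^ c := Real.rpow_pos_of_pos (by linarith) c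
    change a * _ < b * _
    nlinarith
  have hcont : ContinuousOn (fun r : ℝ => r * (1 + r) ^ c) (Set.Icc 0 R) :=
    continuousOn_id.mul (ContinuousOn.rpow_const (by fun_prop) fun _ _ => Or.inr hc.le)
  have hle : R ≤ R * (1 + R) ^ c :=
    le_mul_of_one_le_right hR.le (Real.one_le_rpow (by linarith) hc.le)
  obtain ⟨r, hr, hrR⟩ := intermediate_value_Icc hR.le hcont
    (show R ∈ Set.Icc _ _ from ⟨by simpa using hR.le, hle⟩)
  simp only at hrR
  refine ⟨r, ⟨lt_of_le_of_ne hr.1 ?_, hrR⟩, fun s hs => ?_⟩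
  · rintro rfl
    simp [hR.ne] at hrR
  · exact hmono.injOn hs.1.le hr.1 (hs.2.trans hrR.symm)

lemma arg_mul_one_sub_cpow_lt {c : ℝ} (hc : c ∈ Set.Ioo (0 : ℝ) 1) {w : ℂ} (hw : w.im < 0) :
    (w * (1 - w) ^ (c : ℂ)).arg < Real.pi * c := by
  rw [arg_mul_one_sub_cpow hc (fun h => by simp [h] at hw)
    (one_sub_mem_slitPlane_of_im_ne_zero hw.ne)]
  nlinarith [arg_neg_iff.2 hw, arg_le_pi (1 - w), hc.1]

/-- The case of the negative real axis. -/
lemma existsUnique_of_arg_eq_pi {c : ℝ} (hc : c ∈ Set.Ioo (0 : ℝ) 1) {ζ : ℂ}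
    (hζ : ζ.arg = Real.pi) :
    ∃! w : ℂ, 1 - w ∈ slitPlane ∧ w * (1 - w) ^ (c : ℂ) = ζ := by
  have hζ0 : ζ ≠ 0 := fun h => by simp [h, Real.pi_ne_zero.symm] at hζ
  obtain ⟨r, ⟨hr, hrζ⟩, huniq⟩ := existsUnique_mul_one_add_rpow hc.1 (norm_pos_iff.2 hζ0)
  have hnorm (s : ℝ) (hs : 0 < s) : ‖(-s : ℂ) * (1 - (-s : ℂ)) ^ (c : ℂ)‖ = s * (1 + s) ^ c := by
    have : (1 - (-s : ℂ)) = ((1 + s : ℝ) : ℂ) := by push_cast; ring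
    rw [norm_mul_one_sub_cpow, this, norm_neg, norm_real, norm_real, Real.norm_of_nonneg hs.le,
      Real.norm_of_nonneg (by linarith)]
  have hslit : 1 - (-r : ℂ) ∈ slitPlane := by
    rw [mem_slitPlane_iff]
    left
    simp
    linarith
  refine ⟨-r, ⟨hslit, Complex.ext_norm_arg ((hnorm r hr).trans hrζ) ?_⟩, ?_⟩
  · rw [arg_mul_one_sub_cpow hc (by simpa using hr.ne') hslit,
      arg_one_sub_of_im_eq_zero hslit (by simp), hζ, mul_zero, add_zero, arg_eq_pi_iff]
    simpa using hr
  · rintro v ⟨hvs, hv⟩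
    have hv0 : v ≠ 0 := by rintro rfl; simp [hζ0.symm] at hv
    have harg := arg_mul_one_sub_cpow hc hv0 hvs
    rw [hv, hζ] at harg
    have him : v.im = 0 := by
      rcases lt_trichotomy v.im 0 with h | h | h
      · have := arg_mul_one_sub_cpow_lt hc h
        rw [hv, hζ] at this
        nlinarith [hc.2, Real.pi_pos]
      · exact h
      · nlinarith [(triangle_law_of_sines h).2.1, arg_le_pi v, hc.1]
    rw [arg_one_sub_of_im_eq_zero hvs him, mul_zero, add_zero, eq_comm, arg_eq_pi_iff] at harg
    have hvre : v = -((-v.re : ℝ) : ℂ) := by apply Complex.ext <;> simp [him]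
    have hpos : 0 < -v.re := by linarith [harg.1]
    rw [hvre, ← huniq (-v.re) ⟨hpos, by rw [← hnorm _ hpos, ← hvre, hv]⟩]

lemma existsUnique_of_lt_arg {c : ℝ} (hc : c ∈ Set.Ioo (0 : ℝ) 1) {ζ : ℂ}
    (hζ : Real.pi * c < ζ.arg) :
    ∃! w : ℂ, 1 - w ∈ slitPlane ∧ w * (1 - w) ^ (c : ℂ) = ζ := by
  have hpos : 0 < ζ.arg := (mul_pos Real.pi_pos hc.1).trans hζ
  rcases eq_or_lt_of_le (arg_le_pi ζ) with h | h
  · exact existsUnique_of_arg_eq_pi hc h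
  have hζ0 : ζ ≠ 0 := fun h => by simp [h] at hpos
  have him : 0 < ζ.im := by
    rw [← norm_mul_sin_arg]
    exact mul_pos (norm_pos_iff.2 hζ0) (Real.sin_pos_of_pos_of_lt_pi hpos h)
  obtain ⟨w, ⟨hw, hwζ⟩, huniq⟩ := existsUnique_upper_half_plane hc him
  refine ⟨w, ⟨one_sub_mem_slitPlane_of_im_ne_zero hw.ne', hwζ⟩, ?_⟩
  rintro v ⟨hvs, hv⟩
  refine huniq v ⟨?_, hv⟩
  rcases lt_trichotomy v.im 0 with hv' | hv' | hv'
  · have := arg_mul_one_sub_cpow_lt hc hv'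
    rw [hv] at this
    exact absurd this hζ.not_gt
  · have hv0 : v ≠ 0 := by rintro rfl; simp [hζ0.symm] at hv
    have harg := arg_mul_one_sub_cpow hc hv0 hvs
    rw [hv, arg_one_sub_of_im_eq_zero hvs hv', mul_zero, add_zero] at harg
    rcases lt_or_ge v.re 0 with hre | hre
    · exact absurd (harg.trans (arg_eq_pi_iff.2 ⟨hre, hv'⟩)) h.ne
    · exact absurd (harg.trans (arg_eq_zero_iff.2 ⟨hre, hv'⟩)) hpos.ne'
  · exact hv'

lemma conj_solution {c : ℝ} {w ζ : ℂ}
    (h : 1 - w ∈ slitPlane ∧ w * (1 - w) ^ (c : ℂ) = ζ) :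
    1 - starRingEnd ℂ w ∈ slitPlane ∧
      starRingEnd ℂ w * (1 - starRingEnd ℂ w) ^ (c : ℂ) = starRingEnd ℂ ζ := by
  obtain ⟨hs, rfl⟩ := h
  have e : 1 - starRingEnd ℂ w = starRingEnd ℂ (1 - w) := by simp
  refine ⟨?_, ?_⟩
  · rw [mem_slitPlane_iff] at hs ⊢
    simpa using hs
  · rw [e, conj_cpow _ _ (mem_slitPlane_iff_arg.1 hs).1, conj_ofReal, map_mul]

lemma existsUnique_of_lt_abs_arg {c : ℝ} (hc : c ∈ Set.Ioo (0 : ℝ) 1) {ζ : ℂ}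
    (hζ : Real.pi * c < |ζ.arg|) :
    ∃! w : ℂ, 1 - w ∈ slitPlane ∧ w * (1 - w) ^ (c : ℂ) = ζ := by
  rcases le_or_gt 0 ζ.arg with h | h
  · exact existsUnique_of_lt_arg hc (by rwa [abs_of_nonneg h] at hζ)
  rw [abs_of_neg h] at hζ
  have hconj : Real.pi * c < (starRingEnd ℂ ζ).arg := by
    rwa [arg_conj, if_neg (by linarith [Real.pi_pos])]
  obtain ⟨w, hw, huniq⟩ := existsUnique_of_lt_arg hc hconj
  refine ⟨starRingEnd ℂ w, by simpa using conj_solution hw, fun v hv => ?_⟩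
  rw [← huniq _ (conj_solution hv), conj_conj]

lemma notMem_image_Ici_iff {x : ℝ} (hx : 0 < x) (z : ℂ) :
    z ∉ (fun t : ℝ => (t : ℂ)) '' Set.Ici (x ^ 2)⁻¹ ↔ 1 - (x : ℂ) ^ 2 * z ∈ slitPlane := by
  have hx2 : 0 < x ^ 2 := by positivity
  rw [← not_iff_not, not_not, mem_slitPlane_iff, ← ofReal_pow]
  simp only [Set.mem_image, Set.mem_Ici, sub_re, one_re, re_ofReal_mul, sub_im, one_im,
    im_ofReal_mul, not_or, not_lt, not_not]
  constructor
  · rintro ⟨t, ht, rfl⟩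
    rw [inv_le_iff_one_le_mul₀' hx2] at ht
    simpa using ht
  · rintro ⟨h1, h2⟩
    refine ⟨z.re, ?_, ?_⟩
    · rw [inv_le_iff_one_le_mul₀' hx2]
      linarith
    · apply Complex.ext <;> simp
      simpa [hx.ne', eq_comm] using h2

/-- For `πc < |arg ζ| ≤ π`, the equation `z(1-x²z)^c = ζ` has a unique
solution `z` in `ℂ ∖ [x⁻², ∞)`. -/
theorem phase_map_unique_preimage
    (c x : ℝ) (hc : c ∈ Set.Ioo (0:ℝ) 1) (hx : 0 < x)
    (ζ : ℂ) (hζ : ζ ≠ 0)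
    (harg : Real.pi * c < |ζ.arg|) (harg' : |ζ.arg| ≤ Real.pi) :
    ∃! z : ℂ,
      z ∉ (fun t : ℝ => (t : ℂ)) '' Set.Ici (x ^ 2)⁻¹ ∧
        z * ((1 - (x:ℂ) ^ 2 * z) ^ ((c : ℝ) : ℂ)) = ζ := by
  have hx2 : (x : ℂ) ^ 2 ≠ 0 := by simpa using hx.ne'
  have hscale : ((x : ℂ) ^ 2 * ζ).arg = ζ.arg := by
    rw [← ofReal_pow]
    exact arg_real_mul ζ (by positivity)
  obtain ⟨w, ⟨hws, hw⟩, huniq⟩ := existsUnique_of_lt_abs_arg hc (ζ := (x : ℂ) ^ 2 * ζ)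
    (by rwa [hscale])
  have hcancel : (x : ℂ) ^ 2 * (w / (x : ℂ) ^ 2) = w := mul_div_cancel₀ w hx2
  refine ⟨w / (x : ℂ) ^ 2, ⟨?_, ?_⟩, ?_⟩
  · rwa [notMem_image_Ici_iff hx, hcancel]
  · apply mul_left_cancel₀ hx2
    rw [← mul_assoc, hcancel, hw]
  · rintro v ⟨hvs, hv⟩
    rw [notMem_image_Ici_iff hx] at hvs
    rw [eq_div_iff hx2, mul_comm, huniq _ ⟨hvs, by rw [mul_assoc, hv]⟩]
end

section
/- Let c ∈ (0,1) and x > 0, and define E(z) = z·(1 − x²z)^c for z ∈ ℂ ∖ [x^{-2}, ∞), where (1 − x²z)^c is the principal complex power (note 1 − x²z ∉ (−∞,0] on this domain). If ζ ∈ ℂ ∖ {0} satisfies 0 < |arg ζ| < πc (with arg taking values in (−π, π]), then the set { z ∈ ℂ ∖ [x^{-2}, ∞) : E(z) = ζ } has exactly two elements. -/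
open Complex

/-- The logarithm of `|z (1 - z)^c|` along the curve `arg z = θ + c β`, `arg (1 - z) = -β`. -/
noncomputable def logModulusOnRay (c θ β : ℝ) : ℝ :=
  Real.log (Real.sin β) + c * Real.log (Real.sin (θ + c * β))
    - (1 + c) * Real.log (Real.sin (θ + c * β + β))

/-- The angles `β` for which `θ + c β` and `β` are two angles of a nondegenerate triangle. -/
def triangleAngles (c θ : ℝ) : Set ℝ :=
  {β | 0 < β ∧ 0 < θ + c * β ∧ θ + c * β + β < Real.pi}

lemma convex_triangleAngles (c θ : ℝ) : Convex ℝ (triangleAngles c θ) := by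
  rintro a ⟨ha₁, ha₂, ha₃⟩ b ⟨hb₁, hb₂, hb₃⟩ s t hs ht hst
  obtain rfl : s = 1 - t := by linarith
  have key : ∀ u v : ℝ, 0 < u → 0 < v → 0 < (1 - t) * u + t * v := by
    intro u v hu hv
    rcases ht.eq_or_lt with rfl | ht
    · simpa using hu
    · have := mul_nonneg hs hu.le
      have := mul_pos ht hv
      linarith
  simp only [triangleAngles, Set.mem_ofPred_eq, smul_eq_mul]
  refine ⟨key _ _ ha₁ hb₁, ?_, ?_⟩
  · have := key _ _ ha₂ hb₂
    linarith
  · have := key _ _ (sub_pos.2 ha₃) (sub_pos.2 hb₃)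
    linarith

lemma sin_pos_of_mem_triangleAngles {c θ β : ℝ} (hβ : β ∈ triangleAngles c θ) :
    0 < Real.sin β ∧ 0 < Real.sin (θ + c * β) ∧ 0 < Real.sin (θ + c * β + β) := by
  obtain ⟨h₁, h₂, h₃⟩ := hβ
  refine ⟨Real.sin_pos_of_pos_of_lt_pi ?_ ?_, Real.sin_pos_of_pos_of_lt_pi ?_ ?_,
    Real.sin_pos_of_pos_of_lt_pi ?_ ?_⟩ <;> linarith

lemma hasDerivAt_logModulusOnRay {c θ β : ℝ} (hβ : β ∈ triangleAngles c θ) :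
    HasDerivAt (logModulusOnRay c θ)
      (Real.cos β / Real.sin β + c * (Real.cos (θ + c * β) * c / Real.sin (θ + c * β))
        - (1 + c) * (Real.cos (θ + c * β + β) * (c + 1) / Real.sin (θ + c * β + β))) β := by
  obtain ⟨h₁, h₂, h₃⟩ := sin_pos_of_mem_triangleAngles hβ
  have hα : HasDerivAt (fun b : ℝ => θ + c * b) c β := by
    simpa using ((hasDerivAt_id β).const_mul c).const_add θ
  have hγ : HasDerivAt (fun b : ℝ => θ + c * b + b) (c + 1) β := hα.add (hasDerivAt_id β)
  exact (((Real.hasDerivAt_sin β).log h₁.ne').add ((hα.sin.log h₂.ne').const_mul c)).sub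
    ((hγ.sin.log h₃.ne').const_mul (1 + c))

lemma strictMonoOn_logModulusOnRay {c θ : ℝ} (hc : 0 < c) :
    StrictMonoOn (logModulusOnRay c θ) (triangleAngles c θ) := by
  refine strictMonoOn_of_deriv_pos (convex_triangleAngles c θ)
    (fun β hβ => (hasDerivAt_logModulusOnRay hβ).continuousAt.continuousWithinAt) ?_
  intro β hβ
  replace hβ := interior_subset hβ
  rw [(hasDerivAt_logModulusOnRay hβ).deriv]
  obtain ⟨h₁, h₂, h₃⟩ := sin_pos_of_mem_triangleAngles hβ
  rw [Real.sin_add (θ + c * β) β] at h₃ ⊢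
  rw [Real.cos_add (θ + c * β) β]
  generalize Real.sin β = u at *
  generalize Real.cos β = v at *
  generalize Real.sin (θ + c * β) = p at *
  generalize Real.cos (θ + c * β) = q at *
  have hnum : 0 < (v * p - c * q * u) ^ 2 + (1 + c) ^ 2 * p ^ 2 * u ^ 2 := by positivity
  have heq : v / u + c * (q * c / p) - (1 + c) * ((q * v - p * u) * (c + 1) / (p * v + q * u))
      = ((v * p - c * q * u) ^ 2 + (1 + c) ^ 2 * p ^ 2 * u ^ 2) / (u * p * (p * v + q * u)) := by
    obtain ⟨d, hd⟩ : ∃ d, d = p * v + q * u := ⟨_, rfl⟩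
    rw [← hd] at h₃ ⊢
    field_simp
    rw [hd]
    ring
  rw [heq]
  positivity

lemma exists_logModulusOnRay_eq {c θ : ℝ} (hc : 0 < c) (hc₁ : c < 1) (hθ : θ ≠ 0)
    (hθc : |θ| < Real.pi * c) (L : ℝ) :
    ∃ β ∈ triangleAngles c θ, logModulusOnRay c θ β = L := by
  have hπ := Real.pi_pos
  obtain ⟨hθ₁, hθ₂⟩ := abs_lt.1 hθc
  have hπc : Real.pi * c < Real.pi := by nlinarith
  set lo : ℝ := max 0 (-θ / c) with hlo
  set hi : ℝ := (Real.pi - θ) / (1 + c) with hhi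
  have hhi_eq : θ + c * hi + hi = Real.pi := by
    rw [hhi]
    field_simp
    ring
  have hhi_pos : 0 < hi := div_pos (by linarith) (by linarith)
  have hhi_lt : hi < Real.pi := by
    rw [hhi, div_lt_iff₀ (by linarith)]
    linarith
  have hlohi : lo < hi := by
    refine max_lt hhi_pos ?_
    rw [div_lt_iff₀ hc]
    nlinarith
  set H : ℝ → ℝ := fun β => Real.sin β * Real.sin (θ + c * β) ^ c
    - Real.exp L * Real.sin (θ + c * β + β) ^ (1 + c) with hH
  have hcont : ContinuousOn H (Set.Icc lo hi) := by
    refine Continuous.continuousOn ?_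
    refine (Real.continuous_sin.mul ((by fun_prop : Continuous fun β : ℝ =>
      Real.sin (θ + c * β)).rpow_const fun _ => Or.inr hc.le)).sub
      (continuous_const.mul ((by fun_prop : Continuous fun β : ℝ =>
      Real.sin (θ + c * β + β)).rpow_const fun _ => Or.inr (by linarith)))
  have hHlo : H lo < 0 := by
    have key : ∀ β, (β = 0 ∨ θ + c * β = 0) → 0 < θ + c * β + β → θ + c * β + β < Real.pi →
        H β < 0 := by
      intro β h h₁ h₂
      have : 0 < Real.exp L * Real.sin (θ + c * β + β) ^ (1 + c) :=
        mul_pos (Real.exp_pos L) (Real.rpow_pos_of_pos (Real.sin_pos_of_pos_of_lt_pi h₁ h₂) _)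
      have hz : Real.sin β * Real.sin (θ + c * β) ^ c = 0 := by
        rcases h with h | h
        · simp [h]
        · simp [h, hc.ne']
      simp only [hH, hz]
      linarith
    rcases hθ.lt_or_gt with h | h
    · have hval : lo = -θ / c := max_eq_right (div_nonneg (by linarith) hc.le)
      have hz : θ + c * lo = 0 := by
        rw [hval]
        field_simp
        ring
      refine key lo (Or.inr hz) ?_ ?_
      · rw [hz, hval, zero_add]
        exact div_pos (by linarith) hc
      · linarith
    · have hval : lo = 0 := max_eq_left (div_nonpos_of_nonpos_of_nonneg (by linarith) hc.le)
      refine key lo (Or.inl hval) ?_ ?_ <;> rw [hval] <;> linarith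
  have hHhi : 0 < H hi := by
    simp only [hH, hhi_eq, Real.sin_pi]
    rw [Real.zero_rpow (by linarith), mul_zero, sub_zero]
    refine mul_pos (Real.sin_pos_of_pos_of_lt_pi hhi_pos hhi_lt) (Real.rpow_pos_of_pos ?_ _)
    exact Real.sin_pos_of_pos_of_lt_pi (by linarith) (by linarith)
  obtain ⟨β, ⟨hβ₁, hβ₂⟩, hβ⟩ := intermediate_value_Ioo hlohi.le hcont ⟨hHlo, hHhi⟩
  obtain ⟨hβ₀, hβα⟩ := max_lt_iff.1 hβ₁
  rw [div_lt_iff₀ hc] at hβα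
  have hmem : β ∈ triangleAngles c θ := ⟨hβ₀, by linarith, by nlinarith⟩
  refine ⟨β, hmem, ?_⟩
  obtain ⟨h₁, h₂, h₃⟩ := sin_pos_of_mem_triangleAngles hmem
  have hlog := congrArg Real.log (sub_eq_zero.1 hβ)
  rw [Real.log_mul h₁.ne' (Real.rpow_pos_of_pos h₂ _).ne',
    Real.log_mul (Real.exp_pos L).ne' (Real.rpow_pos_of_pos h₃ _).ne',
    Real.log_rpow h₂, Real.log_rpow h₃, Real.log_exp] at hlog
  unfold logModulusOnRay
  linarith

lemma one_sub_ne_zero_of_im_pos {z : ℂ} (hz : 0 < z.im) : 1 - z ≠ 0 := by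
  intro h
  have := congrArg im h
  simp at this
  linarith

lemma ne_zero_of_im_pos {z : ℂ} (hz : 0 < z.im) : z ≠ 0 := by
  rintro rfl
  simp at hz

/-- The law of sines in the triangle with vertices `0`, `1`, `z`. -/
lemma norm_mul_sin_arg_sub_arg (z : ℂ) :
    ‖z‖ * Real.sin (z.arg + -(1 - z).arg) = Real.sin (-(1 - z).arg) ∧
      ‖1 - z‖ * Real.sin (z.arg + -(1 - z).arg) = Real.sin z.arg := by
  have h₁ := norm_mul_cos_arg z
  have h₂ := norm_mul_sin_arg z
  have h₃ := norm_mul_cos_arg (1 - z)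
  have h₄ := norm_mul_sin_arg (1 - z)
  simp only [sub_re, sub_im, one_re, one_im] at h₃ h₄
  rw [Real.sin_add, Real.sin_neg, Real.cos_neg]
  generalize ‖z‖ = r at *
  generalize ‖1 - z‖ = s at *
  generalize Real.sin z.arg = p at *
  generalize Real.cos z.arg = q at *
  generalize Real.sin (1 - z).arg = u at *
  generalize Real.cos (1 - z).arg = v at *
  constructor
  · linear_combination v * h₂ - u * h₁ + v * h₄ - u * h₃
  · linear_combination p * h₃ - q * h₄ + p * h₁ - q * h₂

lemma mul_one_sub_cpow_eq_exp {z : ℂ} (hz : 0 < z.im) (c : ℝ) :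
    z * (1 - z) ^ (c : ℂ) = exp (log z + c * log (1 - z)) := by
  rw [cpow_def_of_ne_zero (one_sub_ne_zero_of_im_pos hz), exp_add,
    exp_log (ne_zero_of_im_pos hz), mul_comm (log (1 - z))]

/-- In the upper half plane `z (1 - z)^c = ζ` implies an equation between the angles of the
triangle with vertices `0`, `1`, `z`. -/
lemma angles_of_mul_one_sub_cpow_eq {c : ℝ} (hc : 0 < c) (hc₁ : c < 1) {z ζ : ℂ} (hz : 0 < z.im)
    (h : z * (1 - z) ^ (c : ℂ) = ζ) :
    z.arg = ζ.arg + c * -(1 - z).arg ∧ -(1 - z).arg ∈ triangleAngles c ζ.arg ∧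
      logModulusOnRay c ζ.arg (-(1 - z).arg) = Real.log ‖ζ‖ := by
  have hα₀ : 0 < Real.sin z.arg := by
    rw [sin_arg]
    exact div_pos hz (norm_pos_iff.2 (ne_zero_of_im_pos hz))
  have hα : 0 < z.arg := by
    by_contra! hneg
    exact hα₀.not_ge (Real.sin_nonpos_of_nonpos_of_neg_pi_le hneg (neg_pi_lt_arg z).le)
  have hαπ : z.arg < Real.pi := by
    refine (arg_le_pi z).lt_of_ne fun h => ?_
    rw [h, Real.sin_pi] at hα₀
    exact hα₀.false
  have hβ : 0 < -(1 - z).arg := by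
    have : (1 - z).arg < 0 := arg_neg_iff.2 (by simpa using hz)
    linarith
  have hβπ : -(1 - z).arg < Real.pi := by linarith [neg_pi_lt_arg (1 - z)]
  have hsβ := Real.sin_pos_of_pos_of_lt_pi hβ hβπ
  obtain ⟨hr, hs⟩ := norm_mul_sin_arg_sub_arg z
  have hrpos := norm_pos_iff.2 (ne_zero_of_im_pos hz)
  have hspos := norm_pos_iff.2 (one_sub_ne_zero_of_im_pos hz)
  have hsγ : 0 < Real.sin (z.arg + -(1 - z).arg) := by
    rw [← hr] at hsβ
    exact pos_of_mul_pos_right hsβ hrpos.le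
  have hγπ : z.arg + -(1 - z).arg < Real.pi := by
    by_contra! hge
    have := Real.sin_nonneg_of_nonneg_of_le_pi (x := z.arg + -(1 - z).arg - Real.pi)
      (by linarith) (by linarith)
    rw [Real.sin_sub_pi] at this
    linarith
  have hlog : log ζ = log z + c * log (1 - z) := by
    rw [← h, mul_one_sub_cpow_eq_exp hz, log_exp]
    · simp only [add_im, log_im, im_ofReal_mul]
      nlinarith
    · simp only [add_im, log_im, im_ofReal_mul]
      nlinarith
  have him := congrArg im hlog
  have hre := congrArg re hlog
  simp only [add_im, add_re, log_im, log_re, re_ofReal_mul, im_ofReal_mul] at him hre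
  have harg : ζ.arg + c * -(1 - z).arg = z.arg := by linarith
  refine ⟨harg.symm, ⟨hβ, by rwa [harg], by rwa [harg]⟩, ?_⟩
  unfold logModulusOnRay
  rw [harg, hre, ← hr, ← hs, Real.log_mul hrpos.ne' hsγ.ne', Real.log_mul hspos.ne' hsγ.ne']
  ring

lemma existsUnique_mul_one_sub_cpow_eq {c : ℝ} (hc : 0 < c) (hc₁ : c < 1) {ζ : ℂ} (hζ : ζ ≠ 0)
    (harg : ζ.arg ≠ 0) (harg' : |ζ.arg| < Real.pi * c) :
    ∃! z : ℂ, 0 < z.im ∧ z * (1 - z) ^ (c : ℂ) = ζ := by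
  refine existsUnique_of_exists_of_unique ?_ ?_
  · obtain ⟨β, hβ, hL⟩ := exists_logModulusOnRay_eq hc hc₁ harg harg' (Real.log ‖ζ‖)
    obtain ⟨h₁, h₂, h₃⟩ := sin_pos_of_mem_triangleAngles hβ
    obtain ⟨hβ₀, hα₀, hγ⟩ := hβ
    unfold logModulusOnRay at hL
    set α : ℝ := ζ.arg + c * β with hα
    set z : ℂ := ((Real.sin β / Real.sin (α + β) : ℝ) : ℂ) * exp (α * I) with hzdef
    have hr : 0 < Real.sin β / Real.sin (α + β) := div_pos h₁ h₃
    have hs : 0 < Real.sin α / Real.sin (α + β) := div_pos h₂ h₃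
    have hz : 0 < z.im := by
      rw [hzdef, im_ofReal_mul, exp_ofReal_mul_I_im]
      positivity
    have hsub : 1 - z = ((Real.sin α / Real.sin (α + β) : ℝ) : ℂ) * exp ((-β : ℝ) * I) := by
      apply Complex.ext
      · rw [sub_re, hzdef, re_ofReal_mul, re_ofReal_mul, exp_ofReal_mul_I_re,
          exp_ofReal_mul_I_re, one_re, Real.cos_neg]
        field_simp
        rw [Real.sin_add]
        ring
      · rw [sub_im, hzdef, im_ofReal_mul, im_ofReal_mul, exp_ofReal_mul_I_im,
          exp_ofReal_mul_I_im, one_im, Real.sin_neg]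
        ring
    have hlogz : log z = (Real.log (Real.sin β / Real.sin (α + β)) : ℝ) + α * I := by
      rw [hzdef, log_ofReal_mul hr (exp_ne_zero _), log_exp] <;> simp <;> linarith
    have hlogs : log (1 - z) =
        (Real.log (Real.sin α / Real.sin (α + β)) : ℝ) + (-β : ℝ) * I := by
      rw [hsub, log_ofReal_mul hs (exp_ne_zero _), log_exp] <;> simp <;> linarith
    refine ⟨z, hz, ?_⟩
    rw [mul_one_sub_cpow_eq_exp hz]
    conv_rhs => rw [← exp_log hζ]
    congr 1
    rw [hlogz, hlogs, Real.log_div h₁.ne' h₃.ne', Real.log_div h₂.ne' h₃.ne']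
    apply Complex.ext
    · simp [-ofReal_sin, log_re]
      linarith
    · simp [-ofReal_sin, log_im]
      linarith
  · rintro z w ⟨hz, hzζ⟩ ⟨hw, hwζ⟩
    obtain ⟨hz₁, hz₂, hz₃⟩ := angles_of_mul_one_sub_cpow_eq hc hc₁ hz hzζ
    obtain ⟨hw₁, hw₂, hw₃⟩ := angles_of_mul_one_sub_cpow_eq hc hc₁ hw hwζ
    have hβ := (strictMonoOn_logModulusOnRay hc).injOn hz₂ hw₂ (hz₃.trans hw₃.symm)
    have hα : z.arg = w.arg := by rw [hz₁, hw₁, hβ]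
    refine ext_norm_arg ?_ hα
    have hγ := (sin_pos_of_mem_triangleAngles hz₂).2.2
    rw [← hz₁] at hγ
    have h₁ := (norm_mul_sin_arg_sub_arg z).1
    have h₂ := (norm_mul_sin_arg_sub_arg w).1
    rw [← hβ, ← hα, ← h₁] at h₂
    exact (mul_right_cancel₀ hγ.ne' h₂).symm

/-- `z (1 - z)^c` commutes with conjugation off the real axis. -/
lemma conj_mul_one_sub_cpow {z : ℂ} (hz : z.im ≠ 0) (c : ℝ) :
    (starRingEnd ℂ) z * (1 - (starRingEnd ℂ) z) ^ (c : ℂ)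
      = (starRingEnd ℂ) (z * (1 - z) ^ (c : ℂ)) := by
  have harg : (1 - z).arg ≠ Real.pi := by
    intro h
    have := (arg_eq_pi_iff.1 h).2
    simp at this
    exact hz this
  have h := conj_cpow (1 - z) c harg
  rw [map_sub, map_one, conj_ofReal] at h
  rw [h, map_mul]

/-- For `0 < |arg ζ| < πc`, the equation `z(1-x²z)^c = ζ` has exactly two
solutions `z` in `ℂ ∖ [x⁻², ∞)`. -/
theorem phase_map_two_preimages
    (c x : ℝ) (hc : c ∈ Set.Ioo (0:ℝ) 1) (hx : 0 < x)
    (ζ : ℂ) (hζ : ζ ≠ 0)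
    (harg : 0 < |ζ.arg|) (harg' : |ζ.arg| < Real.pi * c) :
    ∃ z₁ z₂ : ℂ, z₁ ≠ z₂ ∧
      {z : ℂ | z ∉ (fun t : ℝ => (t : ℂ)) '' Set.Ici (x ^ 2)⁻¹ ∧
        z * ((1 - (x:ℂ) ^ 2 * z) ^ ((c : ℝ) : ℂ)) = ζ} = {z₁, z₂} := by
  obtain ⟨hc₀, hc₁⟩ := hc
  have hx2 : 0 < x ^ 2 := by positivity
  have hxC : (x : ℂ) ^ 2 ≠ 0 := by exact_mod_cast hx2.ne'
  set ξ : ℂ := (x : ℂ) ^ 2 * ζ with hξ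
  have hξ₀ : ξ ≠ 0 := mul_ne_zero hxC hζ
  have hξarg : ξ.arg = ζ.arg := by
    rw [hξ, ← ofReal_pow, arg_real_mul _ hx2]
  have hπ : |ζ.arg| < Real.pi := by nlinarith [Real.pi_pos]
  have hconj : ((starRingEnd ℂ) ξ).arg = -ζ.arg := by
    rw [arg_conj, hξarg, if_neg]
    intro h
    rw [h, abs_of_pos Real.pi_pos] at hπ
    exact hπ.false
  obtain ⟨w₁, ⟨hw₁, hw₁ξ⟩, huniq₁⟩ := existsUnique_mul_one_sub_cpow_eq hc₀ hc₁ hξ₀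
    (by rw [hξarg]; exact abs_pos.1 harg) (by rwa [hξarg])
  obtain ⟨w₂, ⟨hw₂, hw₂ξ⟩, huniq₂⟩ := existsUnique_mul_one_sub_cpow_eq hc₀ hc₁
    ((map_ne_zero (starRingEnd ℂ)).2 hξ₀)
    (by rw [hconj]; exact neg_ne_zero.2 (abs_pos.1 harg)) (by rwa [hconj, abs_neg])
  have hscale : ∀ z : ℂ, z * (1 - (x : ℂ) ^ 2 * z) ^ (c : ℂ) = ζ ↔
      ((x : ℂ) ^ 2 * z) * (1 - (x : ℂ) ^ 2 * z) ^ (c : ℂ) = ξ := by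
    intro z
    rw [hξ, mul_assoc, mul_right_inj' hxC]
  have him : ∀ z : ℂ, ((x : ℂ) ^ 2 * z).im = x ^ 2 * z.im := by
    intro z
    rw [← ofReal_pow, im_ofReal_mul]
  have hdomain : ∀ z : ℂ, z.im ≠ 0 → z ∉ (fun t : ℝ => (t : ℂ)) '' Set.Ici (x ^ 2)⁻¹ := by
    rintro z hz ⟨t, -, rfl⟩
    exact hz (ofReal_im t)
  have himz₁ : 0 < ((x : ℂ) ^ 2 * (w₁ / (x : ℂ) ^ 2)).im := by rwa [mul_div_cancel₀ _ hxC]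
  have himz₂ : ((x : ℂ) ^ 2 * ((starRingEnd ℂ) w₂ / (x : ℂ) ^ 2)).im < 0 := by
    rw [mul_div_cancel₀ _ hxC, conj_im]
    linarith
  refine ⟨w₁ / (x : ℂ) ^ 2, (starRingEnd ℂ) w₂ / (x : ℂ) ^ 2, ?_, ?_⟩
  · intro h
    rw [h] at himz₁
    linarith
  ext z
  simp only [Set.mem_ofPred_eq, Set.mem_insert_iff, Set.mem_singleton_iff]
  constructor
  · rintro ⟨hdom, hz⟩
    have hzξ := (hscale z).1 hz
    rcases lt_trichotomy z.im 0 with hneg | hzero | hpos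
    · right
      have hneg' : ((x : ℂ) ^ 2 * z).im < 0 := by
        rw [him]
        exact mul_neg_of_pos_of_neg hx2 hneg
      have := huniq₂ ((starRingEnd ℂ) ((x : ℂ) ^ 2 * z))
        ⟨by rw [conj_im]; linarith, by rw [conj_mul_one_sub_cpow hneg'.ne, hzξ]⟩
      rw [← this, conj_conj, mul_div_cancel_left₀ _ hxC]
    · exfalso
      obtain ⟨t, rfl⟩ : ∃ t : ℝ, z = t := ⟨z.re, Complex.ext rfl (by simpa using hzero)⟩
      have ht : 0 ≤ 1 - x ^ 2 * t := by
        by_contra! hlt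
        refine hdom ⟨t, ?_, rfl⟩
        rw [Set.mem_Ici, inv_le_iff_one_le_mul₀ hx2]
        linarith
      have hreal : ζ = ((t * (1 - x ^ 2 * t) ^ c : ℝ) : ℂ) := by
        rw [← hz, ofReal_mul, ofReal_cpow ht]
        push_cast
        rfl
      rcases le_or_gt 0 (t * (1 - x ^ 2 * t) ^ c) with h | h
      · rw [hreal, arg_ofReal_of_nonneg h, abs_zero] at harg
        exact harg.false
      · rw [hreal, arg_ofReal_of_neg h, abs_of_pos Real.pi_pos] at hπ
        exact hπ.false
    · left
      have := huniq₁ ((x : ℂ) ^ 2 * z) ⟨by rw [him]; positivity, hzξ⟩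
      rw [← this, mul_div_cancel_left₀ _ hxC]
  · rintro (rfl | rfl)
    · refine ⟨hdomain _ fun h => ?_, ?_⟩
      · rw [him, h, mul_zero] at himz₁
        exact himz₁.false
      · rwa [hscale, mul_div_cancel₀ _ hxC]
    · refine ⟨hdomain _ fun h => ?_, ?_⟩
      · rw [him, h, mul_zero] at himz₂
        exact himz₂.false
      · rw [hscale, mul_div_cancel₀ _ hxC, conj_mul_one_sub_cpow hw₂.ne', hw₂ξ, conj_conj]
end
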